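/- arXiv:2305.12860 — 2 statements merged into one kernel-verified Lean document; each statement's English description precedes it below -/
import Mathlib

section
/- Let ε > 0 and E, J, Δc ≥ 0 be real numbers, and let h^B, h^G, h^opt, Δh^L : ℕ → ℝ and λ : ℕ → ℝ be sequences satisfying: (i) 0 ≤ h^G_k ≤ h^opt_k for all k; (ii) h^B_0 = h^G_0; (iii) 0 ≤ λ_k ≤ 1 and λ_k · (E·J/ε + Δc + h^G_{k+1}) ≤ h^G_{k+1} for all k; (iv) Δh^L_k ≤ h^opt_{k+1} − h^opt_k + E·J for all k; (v) h^opt_k ≤ h^opt_{k+1} + Δc for all k; (vi) h^B_{k+1} = λ_k · (h^B_k + Δh^L_k) + (1 − λ_k) · h^G_{k+1} for all k. Then h^B_K ≤ (1 + ε) · h^opt_K for every K ∈ ℕ. -/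
theorem balanced_heuristic_suboptimality
    (ε E J Δc : ℝ) (hε : 0 < ε) (hE : 0 ≤ E) (hJ : 0 ≤ J) (hΔc : 0 ≤ Δc)
    (hB hG hopt Δh lam : ℕ → ℝ)
    (h_adm : ∀ k, 0 ≤ hG k ∧ hG k ≤ hopt k)
    (h_init : hB 0 = hG 0)
    (h_lam : ∀ k, 0 ≤ lam k ∧ lam k ≤ 1 ∧
      lam k * (E * J / ε + Δc + hG (k + 1)) ≤ hG (k + 1))
    (h_loc : ∀ k, Δh k ≤ hopt (k + 1) - hopt k + E * J)
    (h_step : ∀ k, hopt k ≤ hopt (k + 1) + Δc)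
    (h_rec : ∀ k, hB (k + 1) = lam k * (hB k + Δh k) + (1 - lam k) * hG (k + 1)) :
    ∀ K : ℕ, hB K ≤ (1 + ε) * hopt K := by
  intro K
  induction K with
  | zero =>
    obtain ⟨h0, h1⟩ := h_adm 0
    rw [h_init]
    nlinarith
  | succ k ih =>
    obtain ⟨-, hle⟩ := h_adm (k + 1)
    obtain ⟨hl0, hl1, hl⟩ := h_lam k
    have hdiv : ε * (E * J / ε) = E * J := mul_div_cancel₀ _ hε.ne'
    have hstep : ε * hopt k ≤ ε * (hopt (k + 1) + Δc) :=
      mul_le_mul_of_nonneg_left (h_step k) hε.le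
    have hsum : hB k + Δh k ≤ (1 + ε) * hopt (k + 1) + ε * (E * J / ε + Δc) := by
      linarith [h_loc k]
    have hbound : lam k * (ε * (E * J / ε + Δc)) ≤ ε * ((1 - lam k) * hG (k + 1)) := by
      linarith [mul_le_mul_of_nonneg_left hl hε.le]
    have hconv : (1 + ε) * ((1 - lam k) * hG (k + 1)) ≤
        (1 + ε) * ((1 - lam k) * hopt (k + 1)) := by
      have : 0 ≤ 1 - lam k := sub_nonneg.2 hl1
      gcongr
    rw [h_rec k]
    linarith [mul_le_mul_of_nonneg_left hsum hl0]
end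

section
/- Let ε > 0 and E, J, Δc ≥ 0 be real numbers, and let hB, hG, hG', hopt, hopt', Δh, λ be real numbers satisfying: 0 ≤ λ ≤ 1; 0 ≤ hG' ≤ hopt'; λ · (E·J/ε + Δc + hG') ≤ hG'; hB ≤ (1 + ε) · hopt; Δh ≤ hopt' − hopt + E·J; and hopt ≤ hopt' + Δc. Then λ · (hB + Δh) + (1 − λ) · hG' ≤ (1 + ε) · hopt'. -/
theorem balanced_heuristic_inductive_step
    (ε E J Δc : ℝ) (hε : 0 < ε) (hE : 0 ≤ E) (hJ : 0 ≤ J) (hΔc : 0 ≤ Δc)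
    (hB hG hG' hopt hopt' Δh lam : ℝ)
    (hlam0 : 0 ≤ lam) (hlam1 : lam ≤ 1)
    (hG'0 : 0 ≤ hG') (hG'le : hG' ≤ hopt')
    (hlamcond : lam * (E * J / ε + Δc + hG') ≤ hG')
    (hind : hB ≤ (1 + ε) * hopt)
    (hloc : Δh ≤ hopt' - hopt + E * J)
    (hstep : hopt ≤ hopt' + Δc) :
    lam * (hB + Δh) + (1 - lam) * hG' ≤ (1 + ε) * hopt' := by
  have hsum : hB + Δh ≤ (1 + ε) * hopt' + ε * (E * J / ε + Δc) := by
    have hcancel : ε * (E * J / ε) = E * J := mul_div_cancel₀ _ hε.ne'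
    have hεstep := mul_le_mul_of_nonneg_left hstep hε.le
    linarith
  have hlamsum := mul_le_mul_of_nonneg_left hsum hlam0
  have hεlam := mul_le_mul_of_nonneg_left hlamcond hε.le
  have hglobal : (1 - lam) * (1 + ε) * hG' ≤ (1 - lam) * (1 + ε) * hopt' :=
    mul_le_mul_of_nonneg_left hG'le (mul_nonneg (sub_nonneg.2 hlam1) (by linarith))
  linarith
end
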